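/- arXiv:0712.4321 — 3 statements merged into one kernel-verified Lean document; each statement's English description precedes it below -/
import Mathlib

section
/- If there exists an F_q-linear pure perfect [[n,k,d]]_q stabilizer code, i.e., one additionally satisfying ∑_{j=0}^{⌊(d−1)/2⌋} C(n,j)(q²−1)^j = q^{n−k}, then for every r in the range 0 ≤ r ≤ k there exists a pure perfect F_q-linear [[n, k−r, r, d]]_q subsystem code, i.e., one satisfying ∑_{j=0}^{⌊(d−1)/2⌋} C(n,j)(q²−1)^j = q^{n−(k−r)−r}. -/
open scoped BigOperators

/-- The symplectic weight of a vector `(x|y) ∈ F_q^n × F_q^n`: the number of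
coordinates `i` with `(x_i, y_i) ≠ (0,0)`. -/
noncomputable def swt {F : Type*} [Field F] {n : ℕ} (v : (Fin n → F) × (Fin n → F)) : ℕ :=
  Nat.card {i : Fin n // ¬(v.1 i = 0 ∧ v.2 i = 0)}

/-- The minimum symplectic weight of the nonzero elements of a set `X`. -/
noncomputable def minSwt {F : Type*} [Field F] {n : ℕ}
    (X : Set ((Fin n → F) × (Fin n → F))) : ℕ :=
  sInf (swt '' {v ∈ X | v ≠ 0})

/-- The trace-symplectic form `⟨(a|b)|(a'|b')⟩ₛ = Tr_{F_q/F_p}(a'·b − a·b')`. -/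
noncomputable def traceSymp (p : ℕ) {F : Type*} [Field F] [Algebra (ZMod p) F] {n : ℕ}
    (u w : (Fin n → F) × (Fin n → F)) : ZMod p :=
  Algebra.trace (ZMod p) F (∑ i, (w.1 i * u.2 i - u.1 i * w.2 i))

/-- The trace-symplectic dual of a set `C ⊆ F_q^{2n}`. -/
def sdual (p : ℕ) {F : Type*} [Field F] [Algebra (ZMod p) F] {n : ℕ}
    (C : Set ((Fin n → F) × (Fin n → F))) : Set ((Fin n → F) × (Fin n → F)) :=
  {v | ∀ w ∈ C, traceSymp p v w = 0}

/-- `C` is (the additive code associated with) an `((n,K,R,d))_q` Clifford subsystem code: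
with `D = C ∩ C^⊥s`, `|C| = q^n R / K`, `|D| = q^n/(KR)`, and `d = swt(D^⊥s − C)` if
`C ≠ D^⊥s`, else `d = swt(D^⊥s)`. -/
def IsSubsysCode (p : ℕ) {F : Type*} [Field F] [Fintype F] [Algebra (ZMod p) F] {n : ℕ}
    (K R d : ℕ) (C : AddSubgroup ((Fin n → F) × (Fin n → F))) : Prop :=
  let S : Set ((Fin n → F) × (Fin n → F)) := ↑C
  let D : Set ((Fin n → F) × (Fin n → F)) := S ∩ sdual p S
  let Dp : Set ((Fin n → F) × (Fin n → F)) := sdual p D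
  K * Nat.card C = Fintype.card F ^ n * R ∧
  K * R * Nat.card D = Fintype.card F ^ n ∧
  (S = Dp → d = minSwt Dp) ∧
  (S ≠ Dp → d = minSwt (Dp \ S))

/-- `C` is (the linear code associated with) an `F_q`-linear `[[n,k,r,d]]_q` subsystem code. -/
def IsLinSubsysCode (p : ℕ) {F : Type*} [Field F] [Fintype F] [Algebra (ZMod p) F] {n : ℕ}
    (k r d : ℕ) (C : Submodule F ((Fin n → F) × (Fin n → F))) : Prop :=
  IsSubsysCode p (Fintype.card F ^ k) (Fintype.card F ^ r) d C.toAddSubgroup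

namespace LinearMap.BilinForm

variable {K V : Type*} [Field K] [AddCommGroup V] [Module K V] [FiniteDimensional K V]
  {B : LinearMap.BilinForm K V}

theorem exists_mem_orthogonal_apply_ne_zero (hB : B.Nondegenerate) (hr : B.IsRefl)
    {E : Submodule K V} {u : V} (hu : u ∉ E) : ∃ w ∈ B.orthogonal E, B w u ≠ 0 := by
  by_contra! h
  exact hu (orthogonal_orthogonal hB hr E ▸ mem_orthogonal_iff.2 h)

/-- A subspace with radical `C` extends by a hyperbolic pair, with prescribed first vector `u`,
to a subspace that still has radical `C`. -/
theorem exists_extend_hyperbolic (hB : B.Nondegenerate) (ha : B.IsAlt)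
    {C E : Submodule K V} (hE : E ⊓ B.orthogonal E = C) {u : V} (hu : u ∈ B.orthogonal E) (huC : u ∉ C) :
    ∃ E' : Submodule K V, E ≤ E' ∧ u ∈ E' ∧ E' ⊓ B.orthogonal E' = C ∧
      Module.finrank K E' = Module.finrank K E + 2 := by
  have hr := ha.isRefl
  have huE : u ∉ E := fun h => huC (hE ▸ ⟨h, hu⟩)
  obtain ⟨w, hw, hwu⟩ := exists_mem_orthogonal_apply_ne_zero hB hr huE
  have hmem : ∀ x, x ∈ (E ⊔ K ∙ u) ⊔ K ∙ w ↔ ∃ e ∈ E, ∃ a b : K, e + a • u + b • w = x := by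
    intro x
    simp only [Submodule.mem_sup, Submodule.mem_span_singleton]
    constructor
    · rintro ⟨_, ⟨e, he, _, ⟨a, rfl⟩, rfl⟩, _, ⟨b, rfl⟩, rfl⟩
      exact ⟨e, he, a, b, rfl⟩
    · rintro ⟨e, he, a, b, rfl⟩
      exact ⟨_, ⟨e, he, _, ⟨a, rfl⟩, rfl⟩, _, ⟨b, rfl⟩, rfl⟩
  have hEu : ∀ e ∈ E, B e u = 0 := fun e he => hu e he
  have hEw : ∀ e ∈ E, B e w = 0 := fun e he => hw e he
  have huw : B u w ≠ 0 := fun h => hwu (hr _ _ h)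
  have hwE : w ∉ E ⊔ K ∙ u := by
    intro h
    obtain ⟨e, he, y, hy, rfl⟩ := Submodule.mem_sup.1 h
    obtain ⟨a, rfl⟩ := Submodule.mem_span_singleton.1 hy
    apply hwu
    simp [hEu e he, ha.self_eq_zero u]
  refine ⟨(E ⊔ K ∙ u) ⊔ K ∙ w, le_sup_left.trans le_sup_left,
    (hmem u).2 ⟨0, E.zero_mem, 1, 0, by simp⟩, ?_, ?_⟩
  · apply le_antisymm
    · rintro x ⟨hx, hxo⟩
      obtain ⟨e, he, a, b, rfl⟩ := (hmem x).1 hx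
      have h1 : B u (e + a • u + b • w) = 0 :=
        hxo u ((hmem u).2 ⟨0, E.zero_mem, 1, 0, by simp⟩)
      have h2 : B w (e + a • u + b • w) = 0 :=
        hxo w ((hmem w).2 ⟨0, E.zero_mem, 0, 1, by simp⟩)
      have hb : b = 0 := by
        simpa [hr _ _ (hEu e he), ha.self_eq_zero u, huw] using h1
      have ha' : a = 0 := by
        simpa [hr _ _ (hEw e he), ha.self_eq_zero w, hwu] using h2
      subst hb ha'
      rw [← hE]
      refine ⟨by simpa using he, fun y hy => ?_⟩
      exact hxo y ((hmem y).2 ⟨y, hy, 0, 0, by simp⟩)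
    · intro c hc
      have hc' := hc
      rw [← hE] at hc'
      refine ⟨(hmem c).2 ⟨c, hc'.1, 0, 0, by simp⟩, fun y hy => ?_⟩
      obtain ⟨e, he, a, b, rfl⟩ := (hmem y).1 hy
      have h3 : B e c = 0 := hc'.2 e he
      show B _ _ = 0
      simp [h3, hr _ _ (hEu c hc'.1), hr _ _ (hEw c hc'.1)]
  · rw [Submodule.finrank_sup_span_singleton hwE, Submodule.finrank_sup_span_singleton huE]

/-- A vector orthogonal to a totally isotropic subspace `C` but not in it lies in a subspace with
radical `C` and dimension `dim C + 2 (s + 1)`, whenever `dim C + s + 1 ≤ dim V - dim C - s - 1`. -/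
theorem exists_mem_radical_eq (hB : B.Nondegenerate) (ha : B.IsAlt) {C : Submodule K V}
    (hC : C ≤ B.orthogonal C) {v : V} (hv : v ∈ B.orthogonal C) (hvC : v ∉ C) (s : ℕ)
    (hs : Module.finrank K C + (s + 1) ≤ Module.finrank K V - Module.finrank K C - s - 1) :
    ∃ E : Submodule K V, C ≤ E ∧ v ∈ E ∧ E ⊓ B.orthogonal E = C ∧
      Module.finrank K E = Module.finrank K C + 2 * (s + 1) := by
  induction s with
  | zero => exact exists_extend_hyperbolic hB ha (inf_eq_left.2 hC) hv hvC
  | succ s ih =>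
    obtain ⟨E, hCE, hvE, hE, hrk⟩ := ih (by lia)
    have hnot : ¬ B.orthogonal E ≤ C := by
      intro h
      have := Submodule.finrank_mono h
      rw [finrank_orthogonal hB, hrk] at this
      lia
    obtain ⟨u, hu, huC⟩ := SetLike.not_le_iff_exists.1 hnot
    obtain ⟨E', hEE', -, hE', hrk'⟩ := exists_extend_hyperbolic hB ha hE hu huC
    exact ⟨E', hCE.trans hEE', hEE' hvE, hE', by lia⟩

end LinearMap.BilinForm

section

variable {F : Type*} [Field F] {n : ℕ}

/-- The symplectic bilinear form `a'·b − a·b'` on `F^n × F^n`. -/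
def sympForm (F : Type*) [Field F] (n : ℕ) :
    LinearMap.BilinForm F ((Fin n → F) × (Fin n → F)) :=
  LinearMap.mk₂ F (fun u w => ∑ i, (w.1 i * u.2 i - u.1 i * w.2 i))
    (fun _ _ _ => by
      rw [← Finset.sum_add_distrib]; exact Finset.sum_congr rfl fun _ _ => by simp; ring)
    (fun _ _ _ => by
      rw [Finset.smul_sum]; exact Finset.sum_congr rfl fun _ _ => by simp; ring)
    (fun _ _ _ => by
      rw [← Finset.sum_add_distrib]; exact Finset.sum_congr rfl fun _ _ => by simp; ring)
    (fun _ _ _ => by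
      rw [Finset.smul_sum]; exact Finset.sum_congr rfl fun _ _ => by simp; ring)

theorem sympForm_apply (u w : (Fin n → F) × (Fin n → F)) :
    sympForm F n u w = ∑ i, (w.1 i * u.2 i - u.1 i * w.2 i) := rfl

theorem sympForm_isAlt : (sympForm F n).IsAlt := fun u => by
  simp [sympForm_apply]

theorem sympForm_nondegenerate : (sympForm F n).Nondegenerate := by
  have h : LinearMap.SeparatingLeft (sympForm F n) := by
    intro u hu
    ext i
    · simpa [sympForm_apply, Pi.single_apply] using hu (0, Pi.single i 1)
    · simpa [sympForm_apply, Pi.single_apply] using hu (Pi.single i 1, 0)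
  refine ⟨h, fun u hu => h u fun w => ?_⟩
  exact sympForm_isAlt.isRefl _ _ (hu w)

/-- On subspaces, the trace-symplectic dual is the orthogonal complement for the symplectic
form. -/
theorem sdual_coe (p : ℕ) [Fact p.Prime] [Finite F] [Algebra (ZMod p) F]
    (C : Submodule F ((Fin n → F) × (Fin n → F))) :
    sdual p (C : Set ((Fin n → F) × (Fin n → F))) = (sympForm F n).orthogonal C := by
  ext v
  have hr := (sympForm_isAlt (F := F) (n := n)).isRefl
  constructor
  · intro hv w hw
    apply hr
    refine (traceForm_nondegenerate (ZMod p) F).1 _ fun c => ?_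
    have h := hv (c • w) (C.smul_mem c hw)
    change Algebra.trace (ZMod p) F (sympForm F n v (c • w)) = 0 at h
    rw [map_smul, smul_eq_mul, mul_comm] at h
    exact h
  · intro hv w hw
    change Algebra.trace (ZMod p) F (sympForm F n v w) = 0
    rw [hr _ _ (hv w hw), map_zero]

theorem minSwt_le {X : Set ((Fin n → F) × (Fin n → F))} {v : (Fin n → F) × (Fin n → F)}
    (hv : v ∈ X) (h0 : v ≠ 0) : minSwt X ≤ swt v :=
  Nat.sInf_le ⟨v, ⟨hv, h0⟩, rfl⟩

theorem le_minSwt {X : Set ((Fin n → F) × (Fin n → F))} {d : ℕ}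
    (hX : ∃ v ∈ X, v ≠ 0) (h : ∀ v ∈ X, v ≠ 0 → d ≤ swt v) : d ≤ minSwt X := by
  obtain ⟨v, hv, h0⟩ := hX
  refine le_csInf ⟨_, v, ⟨hv, h0⟩, rfl⟩ ?_
  rintro _ ⟨w, ⟨hw, hw0⟩, rfl⟩
  exact h w hw hw0

theorem exists_swt_eq_minSwt {X : Set ((Fin n → F) × (Fin n → F))}
    (hX : ∃ v ∈ X, v ≠ 0) : ∃ v ∈ X, v ≠ 0 ∧ swt v = minSwt X := by
  obtain ⟨v, hv, h0⟩ := hX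
  obtain ⟨w, ⟨hw, hw0⟩, h⟩ :=
    Nat.sInf_mem (s := swt '' {v ∈ X | v ≠ 0}) ⟨_, v, ⟨hv, h0⟩, rfl⟩
  exact ⟨w, hw, hw0, h⟩

theorem isLinSubsysCode_iff (p : ℕ) [Fact p.Prime] [Fintype F] [Algebra (ZMod p) F] {k r d : ℕ}
    {C : Submodule F ((Fin n → F) × (Fin n → F))} :
    let D := C ⊓ (sympForm F n).orthogonal C
    IsLinSubsysCode p k r d C ↔
      k + Module.finrank F C = n + r ∧ k + r + Module.finrank F D = n ∧
      (C = (sympForm F n).orthogonal D → d = minSwt (C : Set ((Fin n → F) × (Fin n → F)))) ∧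
      (C ≠ (sympForm F n).orthogonal D →
        d = minSwt (((sympForm F n).orthogonal D : Set ((Fin n → F) × (Fin n → F))) \ C)) := by
  intro D
  have hinj := Nat.pow_right_injective (Fintype.one_lt_card (α := F))
  have hcard (E : Submodule F ((Fin n → F) × (Fin n → F))) :
      Nat.card E = Fintype.card F ^ Module.finrank F E := by
    rw [Module.natCard_eq_pow_finrank (K := F), Nat.card_eq_fintype_card]
  have hD : (C : Set ((Fin n → F) × (Fin n → F))) ∩ sdual p (C : Set _) = (D : Set _) := by
    rw [sdual_coe]; rfl
  have hDcard : Nat.card (D : Set ((Fin n → F) × (Fin n → F))) =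
      Fintype.card F ^ Module.finrank F D := hcard D
  have hCcard : Nat.card C.toAddSubgroup = Fintype.card F ^ Module.finrank F C := hcard C
  unfold IsLinSubsysCode IsSubsysCode
  simp only [Submodule.coe_toAddSubgroup, hD]
  simp only [sdual_coe, hDcard, hCcard, ← pow_add,
    SetLike.coe_set_eq, hinj.eq_iff, ne_eq]
  refine and_congr_right fun _ => and_congr_right fun _ => and_congr_left fun _ => ?_
  exact forall_congr' fun h => by rw [← h]

end

/-- From an `F_q`-linear pure perfect `[[n,k,d]]_q` stabilizer code one gets,
for every `0 ≤ r ≤ k`, a pure perfect `F_q`-linear `[[n,k-r,r,d]]_q` subsystem code. -/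
theorem stmt_17 (p m n : ℕ) [Fact p.Prime] (hm : 0 < m)
    (F : Type) [Field F] [Fintype F] [Algebra (ZMod p) F]
    (hq : Fintype.card F = p ^ m) (k d : ℕ)
    (hex : ∃ C : Submodule F ((Fin n → F) × (Fin n → F)),
      IsLinSubsysCode p k 0 d C ∧ d ≤ minSwt (C : Set ((Fin n → F) × (Fin n → F))))
    (hperf : ∑ j ∈ Finset.range ((d - 1) / 2 + 1),
        n.choose j * (Fintype.card F ^ 2 - 1) ^ j = Fintype.card F ^ (n - k)) :
    ∀ r ≤ k, ∃ C' : Submodule F ((Fin n → F) × (Fin n → F)),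
      IsLinSubsysCode p (k - r) r d C' ∧
      d ≤ minSwt (C' : Set ((Fin n → F) × (Fin n → F))) ∧
      ∑ j ∈ Finset.range ((d - 1) / 2 + 1),
        n.choose j * (Fintype.card F ^ 2 - 1) ^ j = Fintype.card F ^ (n - (k - r) - r) := by
  obtain ⟨C, hC, hpure⟩ := hex
  have hB := sympForm_nondegenerate (F := F) (n := n)
  have ha := sympForm_isAlt (F := F) (n := n)
  have hV : Module.finrank F ((Fin n → F) × (Fin n → F)) = n + n := by simp
  obtain ⟨h1, h2, -, h4⟩ := (isLinSubsysCode_iff p).1 hC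
  set B := sympForm F n with hBdef
  have hinf : C ⊓ B.orthogonal C = C :=
    Submodule.eq_of_le_of_finrank_eq inf_le_left (by lia)
  have hle : C ≤ B.orthogonal C := inf_eq_left.1 hinf
  rw [hinf] at h4
  have hdim := LinearMap.BilinForm.finrank_orthogonal hB C
  have hmin : ∀ x ∈ B.orthogonal C, x ≠ 0 → d ≤ swt x := by
    intro x hx hx0
    by_cases hxC : x ∈ C
    · exact hpure.trans (minSwt_le hxC hx0)
    · have hne : C ≠ B.orthogonal C := fun h => hxC (h ▸ hx)
      exact (h4 hne).le.trans (minSwt_le ⟨hx, hxC⟩ hx0)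
  have hpure' : ∀ C' : Submodule F ((Fin n → F) × (Fin n → F)), C ≤ C' →
      C' ≤ B.orthogonal C → d ≤ minSwt (C' : Set ((Fin n → F) × (Fin n → F))) := by
    intro C' hCC' hC'
    by_cases hbot : C = ⊥
    · subst hbot
      have : d ≤ 0 := by simpa [minSwt] using hpure
      lia
    · obtain ⟨x, hx, hx0⟩ := Submodule.exists_mem_ne_zero_of_ne_bot hbot
      exact le_minSwt ⟨x, hCC' hx, hx0⟩ fun y hy => hmin y (hC' hy)
  intro r hr
  have hexp : n - (k - r) - r = n - k := by lia
  rw [hexp]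
  obtain rfl | hk := Nat.eq_zero_or_pos k
  · obtain rfl : r = 0 := by lia
    exact ⟨C, hC, hpure, hperf⟩
  have hne : C ≠ B.orthogonal C := fun h => by
    rw [← h] at hdim
    lia
  obtain ⟨v₀, hv₀, hv₀C⟩ := SetLike.exists_of_lt (lt_of_le_of_ne hle hne)
  obtain ⟨v, ⟨hv, hvC⟩, hv0, hvd⟩ := exists_swt_eq_minSwt
    (X := (B.orthogonal C : Set ((Fin n → F) × (Fin n → F))) \ C)
    ⟨v₀, ⟨hv₀, hv₀C⟩, fun h => hv₀C (h ▸ C.zero_mem)⟩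
  rw [← h4 hne] at hvd
  have hCC := LinearMap.BilinForm.orthogonal_orthogonal hB ha.isRefl C
  obtain rfl | hlt := eq_or_lt_of_le hr
  · refine ⟨B.orthogonal C, (isLinSubsysCode_iff p).2 ?_, hpure' _ hle le_rfl, hperf⟩
    rw [← hBdef, hCC, inf_eq_right.2 hle]
    refine ⟨by lia, by lia, fun _ => ?_, fun h => absurd rfl h⟩
    exact le_antisymm (hpure' _ hle le_rfl) (hvd ▸ minSwt_le hv hv0)
  · obtain ⟨E, hCE, hvE, hE, hrk⟩ :=
      LinearMap.BilinForm.exists_mem_radical_eq hB ha hle hv hvC (k - r - 1) (by lia)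
    have hEE := LinearMap.BilinForm.orthogonal_orthogonal hB ha.isRefl E
    have hdimE := LinearMap.BilinForm.finrank_orthogonal hB E
    have hEC : B.orthogonal E ≤ B.orthogonal C := LinearMap.BilinForm.orthogonal_le hCE
    have hCE' : C ≤ B.orthogonal E := hE ▸ inf_le_right
    have hvE' : v ∉ B.orthogonal E := fun h => hvC (hE ▸ ⟨hvE, h⟩)
    refine ⟨B.orthogonal E, (isLinSubsysCode_iff p).2 ?_, hpure' _ hCE' hEC, hperf⟩
    rw [← hBdef, hEE, inf_comm, hE]
    refine ⟨by lia, by lia, fun h => absurd (h ▸ hv) hvE', fun _ => ?_⟩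
    exact le_antisymm (le_minSwt ⟨v, ⟨hv, hvE'⟩, hv0⟩ fun y hy => hmin y hy.1)
      (hvd ▸ minSwt_le (Set.mem_sdiff_of_mem hv hvE') hv0)
end

section
/- Let q be a prime power and let F_{q²} be the field with q² elements, containing F_q. If there exists an F_{q²}-linear code X ⊆ F_{q²}^n such that X ⊆ X^⊥h, then there exists an F_q-linear code C ⊆ F_q^{2n} such that C ⊆ C^⊥s, |C| = |X|, swt(C^⊥s − C) = wt(X^⊥h − X), and swt(C) = wt(X). -/
open scoped BigOperators

/-- The Hamming weight of a vector. -/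
noncomputable def hwt {K : Type*} [Field K] {n : ℕ} (x : Fin n → K) : ℕ :=
  Nat.card {i : Fin n // x i ≠ 0}

/-- The minimum Hamming weight of the nonzero elements of a set `Y`. -/
noncomputable def minHwt {K : Type*} [Field K] {n : ℕ} (Y : Set (Fin n → K)) : ℕ :=
  sInf (hwt '' {y ∈ Y | y ≠ 0})

/-- The Hermitian dual `X^⊥h = {x : ∀ y ∈ X, ∑ i, x_i^q y_i = 0}` of a set `X ⊆ F_{q²}^n`. -/
def hdual (q : ℕ) {K : Type*} [Field K] {n : ℕ} (X : Set (Fin n → K)) : Set (Fin n → K) :=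
  {x | ∀ y ∈ X, ∑ i, x i ^ q * y i = 0}

theorem exists_pow_ne_self {K : Type*} [Field K] [Fintype K] {q : ℕ} (hq : 1 < q)
    (hK : Fintype.card K = q ^ 2) : ∃ β : K, β ^ q ≠ β := by
  classical
  by_contra! h
  have hcard := Polynomial.card_le_degree_of_subset_roots (Z := Finset.univ)
    (p := (Polynomial.X ^ q - Polynomial.X : Polynomial K)) (by
      intro x _
      rw [Polynomial.mem_roots (FiniteField.X_pow_card_sub_X_ne_zero K hq)]
      simp [h x])
  rw [FiniteField.X_pow_card_sub_X_natDegree_eq K hq, Finset.card_univ, hK] at hcard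
  nlinarith

section HermitianExpansion

variable {F K : Type*} [Field F] [Field K] [Algebra F K] {n : ℕ}

/-- The coordinatewise expansion map `(a|b) ↦ a + β b`. -/
def expansionMap (β : K) : ((Fin n → F) × (Fin n → F)) →ₗ[F] (Fin n → K) where
  toFun v i := algebraMap F K (v.1 i) + β * algebraMap F K (v.2 i)
  map_add' u v := by
    ext i
    simp only [Prod.fst_add, Prod.snd_add, Pi.add_apply, map_add]
    ring
  map_smul' c v := by
    ext i
    simp only [Prod.smul_fst, Prod.smul_snd, Pi.smul_apply, smul_eq_mul, map_mul,
      RingHom.id_apply]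
    rw [Algebra.smul_def]
    ring

theorem expansionMap_apply (β : K) (v : (Fin n → F) × (Fin n → F)) (i : Fin n) :
    expansionMap β v i = algebraMap F K (v.1 i) + β * algebraMap F K (v.2 i) := rfl

theorem algebraMap_add_mul_algebraMap_eq_zero_iff {β : K}
    (hβ : β ∉ Set.range (algebraMap F K)) (a b : F) :
    algebraMap F K a + β * algebraMap F K b = 0 ↔ a = 0 ∧ b = 0 := by
  refine ⟨fun h => ?_, fun ⟨ha, hb⟩ => by simp [ha, hb]⟩
  have hb : b = 0 := by
    by_contra hb
    have hb' : algebraMap F K b ≠ 0 := by simpa using hb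
    refine hβ ⟨-a / b, ?_⟩
    rw [map_div₀, map_neg, div_eq_iff hb']
    linear_combination -h
  subst hb
  simpa using h

theorem hwt_expansionMap {β : K} (hβ : β ∉ Set.range (algebraMap F K))
    (v : (Fin n → F) × (Fin n → F)) : hwt (expansionMap β v) = swt v := by
  simp only [hwt, swt, ne_eq, expansionMap_apply,
    algebraMap_add_mul_algebraMap_eq_zero_iff hβ]

theorem expansionMap_injective {β : K} (hβ : β ∉ Set.range (algebraMap F K)) :
    Function.Injective (expansionMap (n := n) (F := F) β) := by
  rw [injective_iff_map_eq_zero]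
  intro v hv
  have h i := (algebraMap_add_mul_algebraMap_eq_zero_iff hβ (v.1 i) (v.2 i)).1 (congrFun hv i)
  exact Prod.ext (funext fun i => (h i).1) (funext fun i => (h i).2)

theorem expansionMap_bijective [Fintype F] [Fintype K]
    (hK : Fintype.card K = Fintype.card F ^ 2) {β : K}
    (hβ : β ∉ Set.range (algebraMap F K)) :
    Function.Bijective (expansionMap (n := n) (F := F) β) := by
  classical
  refine (Fintype.bijective_iff_injective_and_card _).2 ⟨expansionMap_injective hβ, ?_⟩
  simp only [Fintype.card_prod, Fintype.card_fun, Fintype.card_fin, hK]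
  ring

theorem minSwt_preimage_expansionMap {β : K} (hβ : β ∉ Set.range (algebraMap F K))
    (hs : Function.Surjective (expansionMap (n := n) (F := F) β)) (Y : Set (Fin n → K)) :
    minSwt (expansionMap (F := F) β ⁻¹' Y) = minHwt Y := by
  have h0 v : expansionMap (n := n) (F := F) β v = 0 ↔ v = 0 :=
    map_eq_zero_iff _ (expansionMap_injective hβ)
  unfold minSwt minHwt
  congr 1
  ext k
  constructor
  · rintro ⟨v, ⟨hv, hne⟩, rfl⟩
    exact ⟨_, ⟨hv, fun h => hne ((h0 v).1 h)⟩, hwt_expansionMap hβ v⟩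
  · rintro ⟨y, ⟨hy, hne⟩, rfl⟩
    obtain ⟨v, rfl⟩ := hs y
    exact ⟨v, ⟨hy, fun h => hne ((h0 v).2 h)⟩, (hwt_expansionMap hβ v).symm⟩

theorem notMem_range_algebraMap_of_pow_card_ne_self [Fintype F] {β : K}
    (hβ : β ^ Fintype.card F ≠ β) : β ∉ Set.range (algebraMap F K) := by
  rintro ⟨a, rfl⟩
  exact hβ (by rw [← map_pow, FiniteField.pow_card])

/-- The symplectic form measures how far the Hermitian form is from being Frobenius-invariant. -/
theorem hermitian_sub_pow_card [Fintype F] [Fintype K]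
    (hK : Fintype.card K = Fintype.card F ^ 2) (β : K) (u w : (Fin n → F) × (Fin n → F)) :
    (∑ i, expansionMap β u i ^ Fintype.card F * expansionMap β w i) ^ Fintype.card F
        - ∑ i, expansionMap β u i ^ Fintype.card F * expansionMap β w i
      = (β - β ^ Fintype.card F) *
        algebraMap F K (∑ i, (w.1 i * u.2 i - u.1 i * w.2 i)) := by
  have hinv (x : K) : (x ^ Fintype.card F) ^ Fintype.card F = x := by
    rw [← pow_mul, ← sq, ← hK, FiniteField.pow_card]
  have hexp (v : (Fin n → F) × (Fin n → F)) (i : Fin n) :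
      expansionMap β v i ^ Fintype.card F
        = algebraMap F K (v.1 i) + β ^ Fintype.card F * algebraMap F K (v.2 i) := by
    have := map_add (FiniteField.frobeniusAlgHom F K) (algebraMap F K (v.1 i))
      (β * algebraMap F K (v.2 i))
    rwa [map_mul, AlgHom.commutes, AlgHom.commutes, FiniteField.frobeniusAlgHom_apply,
      FiniteField.frobeniusAlgHom_apply] at this
  have hsum (f : Fin n → K) :
      (∑ i, f i) ^ Fintype.card F = ∑ i, f i ^ Fintype.card F :=
    map_sum (FiniteField.frobeniusAlgHom F K) f Finset.univ
  rw [hsum, ← Finset.sum_sub_distrib, map_sum, Finset.mul_sum]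
  refine Finset.sum_congr rfl fun i _ => ?_
  rw [mul_pow, hinv, hexp, hexp, expansionMap_apply, expansionMap_apply, map_sub, map_mul,
    map_mul]
  ring

theorem sdual_preimage_expansionMap (p : ℕ) [Fact p.Prime] [Fintype F] [Fintype K]
    [Algebra (ZMod p) F] (hK : Fintype.card K = Fintype.card F ^ 2) {β : K}
    (hβ : β ^ Fintype.card F ≠ β) (hs : Function.Surjective (expansionMap (n := n) (F := F) β))
    (X : Submodule K (Fin n → K)) :
    sdual p (expansionMap (F := F) β ⁻¹' (X : Set (Fin n → K)))
      = expansionMap β ⁻¹' hdual (Fintype.card F) (X : Set (Fin n → K)) := by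
  have hq : Fintype.card F ≠ 0 := Fintype.card_ne_zero
  have hβ' : β - β ^ Fintype.card F ≠ 0 := sub_ne_zero.2 hβ.symm
  ext v
  constructor
  · intro hv
    have hsymp (w : (Fin n → F) × (Fin n → F)) (hw : expansionMap β w ∈ X) :
        ∑ i, (w.1 i * v.2 i - v.1 i * w.2 i) = 0 := by
      by_contra hne
      obtain ⟨b, hb⟩ := Algebra.trace_surjective (ZMod p) F 1
      set s := ∑ i, (w.1 i * v.2 i - v.1 i * w.2 i) with hsdef
      have hmem : expansionMap β ((b / s) • w) ∈ X := by
        rw [map_smul, ← algebraMap_smul K]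
        exact X.smul_mem _ hw
      have h := hv _ hmem
      have hsum : ∑ i, (((b / s) • w).1 i * v.2 i - v.1 i * ((b / s) • w).2 i) = b := by
        refine Eq.trans ?_ (div_mul_cancel₀ b hne)
        conv_rhs => rw [hsdef, Finset.mul_sum, ← hsdef]
        refine Finset.sum_congr rfl fun i _ => ?_
        simp only [Prod.smul_fst, Prod.smul_snd, Pi.smul_apply, smul_eq_mul]
        ring
      rw [traceSymp, hsum, hb] at h
      exact one_ne_zero h
    have hfix (y : Fin n → K) (hy : y ∈ X) :
        (∑ i, expansionMap β v i ^ Fintype.card F * y i) ^ Fintype.card F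
          = ∑ i, expansionMap β v i ^ Fintype.card F * y i := by
      obtain ⟨w, rfl⟩ := hs y
      have h := hermitian_sub_pow_card hK β v w
      rw [hsymp w hy, map_zero, mul_zero] at h
      exact sub_eq_zero.1 h
    intro y hy
    by_contra hne
    set t := ∑ i, expansionMap β v i ^ Fintype.card F * y i with ht
    have hscale : ∑ i, expansionMap β v i ^ Fintype.card F * ((β / t) • y) i = β := by
      refine Eq.trans ?_ (div_mul_cancel₀ β hne)
      conv_rhs => rw [ht, Finset.mul_sum, ← ht]
      refine Finset.sum_congr rfl fun i _ => ?_
      rw [Pi.smul_apply, smul_eq_mul]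
      ring
    have h := hfix _ (X.smul_mem (β / t) hy)
    rw [hscale] at h
    exact hβ h
  · intro hv w hw
    have h := hermitian_sub_pow_card hK β v w
    rw [hv _ hw, zero_pow hq, sub_zero, eq_comm, mul_eq_zero, or_iff_right hβ',
      map_eq_zero] at h
    rw [traceSymp, h, map_zero]

end HermitianExpansion

/-- Hermitian construction: from an `F_{q²}`-linear code `X ⊆ F_{q²}^n` with
`X ⊆ X^⊥h` one gets an `F_q`-linear code `C ⊆ F_q^{2n}` with `C ⊆ C^⊥s`, `|C| = |X|`,
`swt(C^⊥s − C) = wt(X^⊥h − X)`, and `swt(C) = wt(X)`. -/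
theorem stmt_18 (p m : ℕ) [Fact p.Prime] (hm : 0 < m)
    (Fq Fq2 : Type) [Field Fq] [Fintype Fq] [Field Fq2] [Fintype Fq2]
    [Algebra (ZMod p) Fq] [Algebra Fq Fq2]
    (hq : Fintype.card Fq = p ^ m) (hq2 : Fintype.card Fq2 = Fintype.card Fq ^ 2)
    (n : ℕ) (X : Submodule Fq2 (Fin n → Fq2))
    (hX : (X : Set (Fin n → Fq2)) ⊆ hdual (Fintype.card Fq) (X : Set (Fin n → Fq2))) :
    ∃ C : Submodule Fq ((Fin n → Fq) × (Fin n → Fq)),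
      (C : Set ((Fin n → Fq) × (Fin n → Fq))) ⊆
        sdual p (C : Set ((Fin n → Fq) × (Fin n → Fq))) ∧
      Nat.card C = Nat.card X ∧
      minSwt (sdual p (C : Set ((Fin n → Fq) × (Fin n → Fq))) \
          (C : Set ((Fin n → Fq) × (Fin n → Fq))))
        = minHwt (hdual (Fintype.card Fq) (X : Set (Fin n → Fq2)) \ (X : Set (Fin n → Fq2))) ∧
      minSwt (C : Set ((Fin n → Fq) × (Fin n → Fq))) = minHwt (X : Set (Fin n → Fq2)) := by
  obtain ⟨β, hβ⟩ := exists_pow_ne_self Fintype.one_lt_card hq2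
  have hrange := notMem_range_algebraMap_of_pow_card_ne_self hβ
  have hbij := expansionMap_bijective (n := n) hq2 hrange
  have hdualEq := sdual_preimage_expansionMap p hq2 hβ hbij.2 X
  refine ⟨(X.restrictScalars Fq).comap (expansionMap β), ?_, ?_, ?_, ?_⟩
  · rw [Submodule.comap_coe, Submodule.coe_restrictScalars, hdualEq]
    exact Set.preimage_mono hX
  · exact Nat.card_congr
      ((Equiv.ofBijective _ hbij).subtypeEquiv fun _ => Iff.rfl)
  · rw [Submodule.comap_coe, Submodule.coe_restrictScalars, hdualEq, ← Set.preimage_sdiff]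
    exact minSwt_preimage_expansionMap hrange hbij.2 _
  · exact minSwt_preimage_expansionMap hrange hbij.2 _
end

section
/- Let q be a prime power, F_{q²} the field with q² elements containing F_q, and {1, β} an F_q-basis of F_{q²}. If u, v, u', v' ∈ F_q^n are such that the Hermitian inner product ⟨u + βv | u' + βv'⟩_h = ∑_{i=1}^n (u_i + βv_i)^q (u'_i + βv'_i) is zero, then u·v' − v·u' = 0, i.e., the vectors (u|v) and (u'|v') in F_q^{2n} are symplectically orthogonal. -/
open scoped BigOperators

/-- The `q`-power Frobenius of a finite extension of `F_q` fixes only the elements of `F_q`. -/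
theorem FiniteField.mem_range_algebraMap_of_pow_card_eq {K L : Type*} [Field K] [Fintype K]
    [Field L] [Finite L] [Algebra K L] {x : L} (hx : x ^ Fintype.card K = x) :
    x ∈ Set.range (algebraMap K L) := by
  refine (IsGalois.mem_range_algebraMap_iff_fixed x).2 fun g => ?_
  obtain ⟨k, rfl⟩ := (FiniteField.bijective_frobeniusAlgEquivOfAlgebraic_pow K L).2 g
  rw [AlgEquiv.coe_pow]
  exact Function.iterate_fixed hx k

/-- If `{1, β}` is an `F_q`-basis of `F_{q²}` and the Hermitian inner product
`⟨u + βv | u' + βv'⟩_h = ∑ i, (u_i + βv_i)^q (u'_i + βv'_i)` vanishes for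
`u, v, u', v' ∈ F_q^n`, then `u·v' − v·u' = 0`. -/
theorem stmt_19 (Fq Fq2 : Type) [Field Fq] [Fintype Fq] [Field Fq2] [Fintype Fq2]
    [Algebra Fq Fq2] (β : Fq2)
    (hb : LinearIndependent Fq ![(1 : Fq2), β])
    (hspan : Submodule.span Fq {(1 : Fq2), β} = ⊤)
    (n : ℕ) (u v u' v' : Fin n → Fq)
    (h : ∑ i, (algebraMap Fq Fq2 (u i) + β * algebraMap Fq Fq2 (v i)) ^ Fintype.card Fq *
        (algebraMap Fq Fq2 (u' i) + β * algebraMap Fq Fq2 (v' i)) = 0) :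
    ∑ i, (u i * v' i - v i * u' i) = 0 := by
  have hβ : β ^ Fintype.card Fq ≠ β := fun hfix => by
    obtain ⟨a, ha⟩ := FiniteField.mem_range_algebraMap_of_pow_card_eq hfix
    have := LinearIndependent.pair_iff.1 hb a (-1) (by simp [Algebra.smul_def, ha])
    simp at this
  have hrank : Module.finrank Fq Fq2 = 2 := by
    rw [Module.finrank_eq_card_basis (Module.Basis.mk hb (by simp [Set.pair_comm β, hspan])), Fintype.card_fin]
  have hinv : (β ^ Fintype.card Fq) ^ Fintype.card Fq = β := by
    have hcard : Fintype.card Fq2 = Fintype.card Fq ^ 2 := by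
      rw [Module.card_eq_pow_finrank (K := Fq), hrank]
    rw [← pow_mul, ← sq, ← hcard, FiniteField.pow_card]
  let σ := FiniteField.frobeniusAlgHom Fq Fq2
  have hσ (x : Fq2) : x ^ Fintype.card Fq = σ x := rfl
  simp only [hσ] at h hβ hinv
  have hconj := congrArg σ h
  simp only [map_sum, map_mul, map_add, map_zero, AlgHom.commutes, hinv] at h hconj
  have hprod : (β - σ β) * algebraMap Fq Fq2 (∑ i, (u i * v' i - v i * u' i)) = 0 := by
    rw [← sub_self (0 : Fq2)]
    nth_rewrite 1 [← h]
    rw [← hconj, ← Finset.sum_sub_distrib, map_sum, Finset.mul_sum]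
    refine Finset.sum_congr rfl fun i _ => ?_
    simp only [map_sub, map_mul]
    ring
  exact (map_eq_zero _).1 ((mul_eq_zero.1 hprod).resolve_left (sub_ne_zero.2 hβ.symm))
end
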